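/- arXiv:1304.2163 — 2 statements merged into one kernel-verified Lean document; each statement's English description precedes it below -/
import Mathlib

section
/- Let k, s be positive integers with s > 2k, and consider the planar vector field X_{m,k,s}(x,y) = (y³ − x^{2k+1}, −x + m·y^{2s+1}). Then for every m ∈ ℝ the origin is an attractor (locally asymptotically stable) for X_{m,k,s}. -/
open Real Filter Set

noncomputable section

/-- The generalized Bacciotti system
`X_{m,k,s}(x,y) = (y³ − x^{2k+1}, −x + m·y^{2s+1})`. -/
def genBacciotti (m : ℝ) (k s : ℕ) (p : ℝ × ℝ) : ℝ × ℝ :=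
  (p.2 ^ 3 - p.1 ^ (2 * k + 1), -p.1 + m * p.2 ^ (2 * s + 1))

/-- A forward solution of the vector field `X`, defined for all `t ≥ 0`. -/
def IsForwardSolution (X : ℝ × ℝ → ℝ × ℝ) (γ : ℝ → ℝ × ℝ) : Prop :=
  ∀ t ∈ Set.Ici (0 : ℝ), HasDerivWithinAt γ (X (γ t)) (Set.Ici (0 : ℝ)) t

/-- The origin is an attractor (locally asymptotically stable) for the planar
vector field `X`: it is Lyapunov stable, and there is a neighborhood of the
origin all of whose points have forward orbits defined for all `t ≥ 0` and
tending to the origin as `t → +∞`. -/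
def OriginIsAttractor (X : ℝ × ℝ → ℝ × ℝ) : Prop :=
  (∀ ε > (0 : ℝ), ∃ δ > (0 : ℝ), ∀ γ : ℝ → ℝ × ℝ,
      IsForwardSolution X γ → ‖γ 0‖ < δ → ∀ t ≥ (0 : ℝ), ‖γ t‖ < ε) ∧
  (∃ δ > (0 : ℝ), ∀ p : ℝ × ℝ, ‖p‖ < δ →
      ∃ γ : ℝ → ℝ × ℝ, IsForwardSolution X γ ∧ γ 0 = p ∧
        Tendsto γ atTop (nhds (0 : ℝ × ℝ)))

/-- The origin is a repeller for `X`: an attractor for the time-reversed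
vector field `−X`. -/
def OriginIsRepeller (X : ℝ × ℝ → ℝ × ℝ) : Prop :=
  OriginIsAttractor fun p => -X p

open scoped Topology NNReal

/-- A bounded Lipschitz vector field has a forward solution from every initial point. -/
theorem exists_isForwardSolution_of_lipschitzWith {F : ℝ × ℝ → ℝ × ℝ} {K L : ℝ≥0}
    (hF : LipschitzWith K F) (hL : ∀ p, ‖F p‖ ≤ L) (p : ℝ × ℝ) :
    ∃ γ, IsForwardSolution F γ ∧ γ 0 = p := by
  have hloc : ∀ n : ℕ, ∃ α : ℝ → ℝ × ℝ, α 0 = p ∧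
      ∀ t ∈ Icc (0 : ℝ) n, HasDerivWithinAt α (F (α t)) (Icc (0 : ℝ) n) t := by
    intro n
    have h : IsPicardLindelof (fun _ => F) (⟨0, le_rfl, n.cast_nonneg⟩ : Icc (0 : ℝ) n) p
        (L * n) 0 L K := by
      refine .of_time_independent (fun x _ => hL x) hF.lipschitzOnWith ?_
      simp
    exact h.exists_eq_forall_mem_Icc_hasDerivWithinAt₀
  choose α hα0 hα using hloc
  have hderiv : ∀ n : ℕ, ∀ t ∈ Ico (0 : ℝ) n, HasDerivWithinAt (α n) (F (α n t)) (Ici 0) t := by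
    intro n t ht
    refine (hα n t ⟨ht.1, ht.2.le⟩).mono_of_mem_nhdsWithin ?_
    rw [← Ici_inter_Iic]
    exact inter_mem self_mem_nhdsWithin (mem_nhdsWithin_of_mem_nhds (Iic_mem_nhds ht.2))
  have heq : ∀ n n' : ℕ, n ≤ n' → EqOn (α n) (α n') (Icc 0 n) := by
    intro n n' hn
    have hn' : (n : ℝ) ≤ n' := by exact_mod_cast hn
    refine ODE_solution_unique (v := fun _ => F) (fun _ => hF)
      (fun t ht => (hα n t ht).continuousWithinAt)
      (fun t ht => (hderiv n t ht).mono (Ici_subset_Ici.2 ht.1))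
      (fun t ht => ((hα n' t ⟨ht.1, ht.2.trans hn'⟩).mono
        (Icc_subset_Icc_right hn')).continuousWithinAt)
      (fun t ht => (hderiv n' t ⟨ht.1, ht.2.trans_le hn'⟩).mono (Ici_subset_Ici.2 ht.1)) ?_
    rw [hα0, hα0]
  have hglue : ∀ n : ℕ, ∀ t ∈ Ico (0 : ℝ) n, α (⌊t⌋₊ + 1) t = α n t := by
    intro n t ht
    refine heq _ _ ?_ ⟨ht.1, ?_⟩
    · exact (Nat.floor_lt ht.1).2 ht.2
    · exact_mod_cast (Nat.lt_floor_add_one t).le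
  refine ⟨fun t => α (⌊t⌋₊ + 1) t, fun t ht => ?_, hα0 _⟩
  have ht' : t ∈ Ico (0 : ℝ) ((⌊t⌋₊ + 1 : ℕ) : ℝ) := ⟨ht, by exact_mod_cast Nat.lt_floor_add_one t⟩
  refine (hderiv _ t ht').congr_of_eventuallyEq ?_ rfl
  filter_upwards [self_mem_nhdsWithin, mem_nhdsWithin_of_mem_nhds (Iio_mem_nhds ht'.2)] with u hu hu'
  exact hglue _ u ⟨hu, hu'⟩

/-- `V` is a Lyapunov function for the vector field `F` on the closed ball of radius `r`: it is
bounded below by a multiple of a power of the norm and decays along `F` at least as fast as a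
multiple of a power of itself. -/
structure IsLyapunovOn (F : ℝ × ℝ → ℝ × ℝ) (V : ℝ × ℝ → ℝ) (V' : ℝ × ℝ → ℝ × ℝ →L[ℝ] ℝ)
    (r a c : ℝ) (i n : ℕ) : Prop where
  hasFDerivAt : ∀ p, HasFDerivAt V (V' p) p
  map_zero : V 0 = 0
  radius_pos : 0 < r
  lower_pos : 0 < a
  rate_pos : 0 < c
  exponent_ne_zero : i ≠ 0
  lower : ∀ p, ‖p‖ ≤ r → a * ‖p‖ ^ i ≤ V p
  decay : ∀ p, ‖p‖ ≤ r → V' p (F p) ≤ -(c * V p ^ n)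

namespace IsLyapunovOn

variable {F G : ℝ × ℝ → ℝ × ℝ} {V : ℝ × ℝ → ℝ} {V' : ℝ × ℝ → ℝ × ℝ →L[ℝ] ℝ} {r a c : ℝ} {i n : ℕ}
  {γ : ℝ → ℝ × ℝ}

theorem congr (h : IsLyapunovOn F V V' r a c i n) (hFG : ∀ p, ‖p‖ ≤ r → F p = G p) :
    IsLyapunovOn G V V' r a c i n :=
  { h with decay := fun p hp => hFG p hp ▸ h.decay p hp }

theorem nonneg (h : IsLyapunovOn F V V' r a c i n) {p : ℝ × ℝ} (hp : ‖p‖ ≤ r) : 0 ≤ V p :=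
  (mul_nonneg h.lower_pos.le (by positivity)).trans (h.lower p hp)

theorem hasDerivWithinAt (h : IsLyapunovOn F V V' r a c i n) (hγ : IsForwardSolution F γ) {t : ℝ}
    (ht : 0 ≤ t) : HasDerivWithinAt (fun u => V (γ u)) (V' (γ t) (F (γ t))) (Ici 0) t :=
  (h.hasFDerivAt (γ t)).comp_hasDerivWithinAt t (hγ t ht)

/-- Along a solution staying in the ball where `V` is Lyapunov and where `V` stays above `η`,
the function `V` decays at least linearly. -/
theorem antitoneOn (h : IsLyapunovOn F V V' r a c i n) (hγ : IsForwardSolution F γ) {D : Set ℝ}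
    (hD : Convex ℝ D) (hD0 : D ⊆ Ici 0) (hr : ∀ t ∈ D, ‖γ t‖ ≤ r) {η : ℝ} (hη : 0 ≤ η)
    (hVη : ∀ t ∈ D, η ≤ V (γ t)) :
    AntitoneOn (fun t => V (γ t) + c * η ^ n * t) D := by
  have hder : ∀ t ∈ D, HasDerivWithinAt (fun t => V (γ t) + c * η ^ n * t)
      (V' (γ t) (F (γ t)) + c * η ^ n) D t := fun t ht => by
    have h1 := ((h.hasDerivWithinAt hγ (hD0 ht)).mono hD0).add
      ((hasDerivWithinAt_id t D).const_mul (c * η ^ n))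
    rwa [mul_one] at h1
  refine antitoneOn_of_hasDerivWithinAt_nonpos hD (fun t ht => (hder t ht).continuousWithinAt)
    (fun t ht => (hder t (interior_subset ht)).mono interior_subset) fun t ht => ?_
  have ht := interior_subset ht
  have h1 := h.decay _ (hr t ht)
  have h2 : c * η ^ n ≤ c * V (γ t) ^ n :=
    mul_le_mul_of_nonneg_left (pow_le_pow_left₀ hη (hVη t ht) n) h.rate_pos.le
  linarith

theorem norm_lt (h : IsLyapunovOn F V V' r a c i n) (hγ : IsForwardSolution F γ) {ε : ℝ}
    (hεr : ε ≤ r) (h0 : ‖γ 0‖ < ε) (hV0 : V (γ 0) < a * ε ^ i) {t : ℝ} (ht : 0 ≤ t) :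
    ‖γ t‖ < ε := by
  by_contra! hcon
  have hcont : ContinuousOn (fun u => ‖γ u‖) (Icc 0 t) := fun u hu =>
    ((hγ u hu.1).continuousWithinAt.mono Icc_subset_Ici_self).norm
  have hclosed : IsCompact (Icc 0 t ∩ (fun u => ‖γ u‖) ⁻¹' Ici ε) :=
    isCompact_Icc.of_isClosed_subset (hcont.preimage_isClosed_of_isClosed isClosed_Icc isClosed_Ici)
      inter_subset_left
  obtain ⟨T, ⟨hT, hTε⟩, hleast⟩ := hclosed.exists_isLeast ⟨t, ⟨ht, le_rfl⟩, hcon⟩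
  have hbefore : ∀ u ∈ Icc 0 t, u < T → ‖γ u‖ < ε := fun u hu huT => by
    by_contra! hu'
    exact huT.not_ge (hleast ⟨hu, hu'⟩)
  have hT0 : 0 < T := lt_of_le_of_ne hT.1 fun h0T => by
    subst h0T
    exact h0.not_ge hTε
  obtain ⟨u, hu, huε⟩ : ε ∈ (fun u => ‖γ u‖) '' Icc 0 T :=
    intermediate_value_Icc hT.1 (hcont.mono (Icc_subset_Icc_right hT.2)) ⟨h0.le, hTε⟩
  have huT : u = T := by
    by_contra hne
    exact (hbefore u ⟨hu.1, hu.2.trans hT.2⟩ (lt_of_le_of_ne hu.2 hne)).ne huε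
  subst huT
  have hle : ∀ v ∈ Icc 0 u, ‖γ v‖ ≤ r := fun v hv => by
    refine le_trans ?_ hεr
    rcases hv.2.lt_or_eq with hvu | rfl
    · exact (hbefore v ⟨hv.1, hv.2.trans hT.2⟩ hvu).le
    · exact huε.le
  have hanti := h.antitoneOn hγ (convex_Icc 0 u) Icc_subset_Ici_self hle le_rfl
    fun v hv => h.nonneg (hle v hv)
  have h1 := hanti ⟨le_rfl, hT.1⟩ ⟨hT.1, le_rfl⟩ hT.1
  have h2 := h.lower (γ u) (hle u ⟨hT.1, le_rfl⟩)
  have h3 : 0 ≤ c * 0 ^ n * u := mul_nonneg (mul_nonneg h.rate_pos.le (by positivity)) hT.1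
  simp only at huε h1
  rw [huε] at h2
  linarith

theorem exists_stable (h : IsLyapunovOn F V V' r a c i n) {ε : ℝ} (hε : 0 < ε) :
    ∃ δ > (0 : ℝ), ∀ p, ‖p‖ < δ → ‖p‖ < ε ∧ V p < a * ε ^ i := by
  have hpos : V 0 < a * ε ^ i := by
    rw [h.map_zero]
    exact mul_pos h.lower_pos (by positivity)
  have hV := (h.hasFDerivAt 0).continuousAt.eventually_lt continuousAt_const hpos
  obtain ⟨δ, hδ, hball⟩ := Metric.eventually_nhds_iff.1 hV
  refine ⟨min δ ε, lt_min hδ hε, fun p hp => ⟨hp.trans_le (min_le_right _ _), hball ?_⟩⟩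
  simpa using hp.trans_le (min_le_left _ _)

theorem tendsto_zero (h : IsLyapunovOn F V V' r a c i n) (hγ : IsForwardSolution F γ)
    (hr : ∀ t ≥ 0, ‖γ t‖ ≤ r) : Tendsto γ atTop (𝓝 0) := by
  have hV0 : ∀ t ≥ 0, 0 ≤ V (γ t) := fun t ht => h.nonneg (hr t ht)
  have hsmall : ∀ η > (0 : ℝ), ∃ t ≥ 0, V (γ t) < η := by
    intro η hη
    by_contra! hcon
    have hanti := h.antitoneOn hγ (convex_Ici 0) Subset.rfl hr hη.le hcon
    have hrate : 0 < c * η ^ n := mul_pos h.rate_pos (by positivity)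
    have ht : 0 ≤ V (γ 0) / (c * η ^ n) := div_nonneg (hV0 0 le_rfl) hrate.le
    have h1 := hanti self_mem_Ici ht ht
    have h2 := hcon _ ht
    simp only [mul_div_cancel₀ _ hrate.ne'] at h1
    linarith
  have hanti : ∀ t u, 0 ≤ t → t ≤ u → V (γ u) ≤ V (γ t) := by
    intro t u ht htu
    have h1 := h.antitoneOn hγ (convex_Ici 0) Subset.rfl hr le_rfl hV0 ht (ht.trans htu) htu
    have h2 : c * 0 ^ n * t ≤ c * 0 ^ n * u :=
      mul_le_mul_of_nonneg_left htu (mul_nonneg h.rate_pos.le (by positivity))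
    simp only at h1
    linarith
  rw [Metric.tendsto_atTop]
  intro ε hε
  obtain ⟨T, hT, hVT⟩ := hsmall (a * ε ^ i) (mul_pos h.lower_pos (by positivity))
  refine ⟨T, fun t ht => ?_⟩
  have h1 := (h.lower _ (hr t (hT.trans ht))).trans_lt ((hanti T t hT ht).trans_lt hVT)
  rw [dist_zero_right]
  exact lt_of_pow_lt_pow_left₀ i hε.le (lt_of_mul_lt_mul_left h1 h.lower_pos.le)

end IsLyapunovOn

/-- Retraction of the plane onto the square `[-1, 1] × [-1, 1]`. -/
def clampUnitSquare (p : ℝ × ℝ) : ℝ × ℝ :=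
  (max (-1) (min 1 p.1), max (-1) (min 1 p.2))

theorem lipschitzWith_clampUnitSquare : LipschitzWith 1 clampUnitSquare := by
  have h := ((LipschitzWith.prod_fst (α := ℝ) (β := ℝ)).const_min 1 |>.const_max (-1)).prodMk
    ((LipschitzWith.prod_snd (α := ℝ) (β := ℝ)).const_min 1 |>.const_max (-1))
  rwa [max_self] at h

theorem clampUnitSquare_mem (p : ℝ × ℝ) : clampUnitSquare p ∈ Metric.closedBall (0 : ℝ × ℝ) 1 := by
  simp [clampUnitSquare, Prod.norm_def, abs_le]

theorem clampUnitSquare_eq_self {p : ℝ × ℝ} (hp : ‖p‖ ≤ 1) : clampUnitSquare p = p := by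
  simp only [Prod.norm_def, Real.norm_eq_abs, max_le_iff, abs_le] at hp
  simp [clampUnitSquare, hp]

theorem originIsAttractor_of_isLyapunovOn {X : ℝ × ℝ → ℝ × ℝ} {V : ℝ × ℝ → ℝ}
    {V' : ℝ × ℝ → ℝ × ℝ →L[ℝ] ℝ} {r a c : ℝ} {i n : ℕ} (hX : ContDiff ℝ 1 X)
    (h : IsLyapunovOn X V V' r a c i n) (hr : r ≤ 1) : OriginIsAttractor X := by
  refine ⟨fun ε hε => ?_, ?_⟩
  · obtain ⟨δ, hδ, hp⟩ := h.exists_stable (lt_min hε h.radius_pos)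
    refine ⟨δ, hδ, fun γ hγ h0 t ht => ?_⟩
    exact (h.norm_lt hγ (min_le_right ε r) (hp _ h0).1 (hp _ h0).2 ht).trans_le (min_le_left _ _)
  · obtain ⟨K, hK⟩ := hX.contDiffOn.exists_lipschitzOnWith one_ne_zero
      (convex_closedBall (0 : ℝ × ℝ) 1) (isCompact_closedBall 0 1)
    obtain ⟨L, hL⟩ := (isCompact_closedBall (0 : ℝ × ℝ) 1).exists_bound_of_continuousOn
      hX.continuous.continuousOn
    have hlip : LipschitzWith (K * 1) (X ∘ clampUnitSquare) :=
      lipschitzOnWith_univ.1 (hK.comp lipschitzWith_clampUnitSquare.lipschitzOnWith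
        fun p _ => clampUnitSquare_mem p)
    have hagree : ∀ p, ‖p‖ ≤ r → X p = (X ∘ clampUnitSquare) p := fun p hp => by
      rw [Function.comp_apply, clampUnitSquare_eq_self (hp.trans hr)]
    have h' := h.congr hagree
    obtain ⟨δ, hδ, hp⟩ := h.exists_stable h.radius_pos
    refine ⟨δ, hδ, fun p hpδ => ?_⟩
    obtain ⟨γ, hγ, rfl⟩ := exists_isForwardSolution_of_lipschitzWith (L := L.toNNReal) hlip
      (fun q => (hL _ (clampUnitSquare_mem q)).trans (Real.le_coe_toNNReal L)) p
    have hball : ∀ t ≥ 0, ‖γ t‖ ≤ r := fun t ht =>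
      (h'.norm_lt hγ le_rfl (hp _ hpδ).1 (hp _ hpδ).2 ht).le
    refine ⟨γ, fun t ht => ?_, rfl, h'.tendsto_zero hγ hball⟩
    rw [hagree _ (hball t ht)]
    exact hγ t ht

theorem contDiff_genBacciotti (m : ℝ) (k s : ℕ) : ContDiff ℝ 1 (genBacciotti m k s) := by
  unfold genBacciotti
  fun_prop

/-- Weighted Young inequality for `x² y^{4k}`, which is quasi-homogeneous of the same degree as
`x^{2k+2}` and `y^{4k+4}`. -/
theorem sq_mul_pow_le (x y : ℝ) (k : ℕ) {δ : ℝ} (hδ : 0 < δ) :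
    x ^ 2 * y ^ (4 * k) ≤ δ * y ^ (4 * k + 4) + (δ⁻¹) ^ k * x ^ (2 * k + 2) := by
  have hA : 0 ≤ x ^ (2 * k + 2) := Even.pow_nonneg ⟨k + 1, by ring⟩ x
  have hB : 0 ≤ y ^ (4 * k + 4) := Even.pow_nonneg ⟨2 * k + 2, by ring⟩ y
  have hY : 0 ≤ y ^ (4 * k) := Even.pow_nonneg ⟨2 * k, by ring⟩ y
  rcases le_total (x ^ 2) (δ * y ^ 4) with hc | hc
  · have h1 := mul_le_mul_of_nonneg_right hc hY
    have h2 : 0 ≤ (δ⁻¹) ^ k * x ^ (2 * k + 2) := by positivity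
    calc x ^ 2 * y ^ (4 * k) ≤ δ * y ^ 4 * y ^ (4 * k) := h1
      _ = δ * y ^ (4 * k + 4) := by ring
      _ ≤ _ := by linarith
  · have hc' : y ^ 4 ≤ δ⁻¹ * x ^ 2 := by
      rw [inv_mul_eq_div, le_div_iff₀ hδ]
      linarith
    have h1 : y ^ (4 * k) ≤ (δ⁻¹ * x ^ 2) ^ k := by
      rw [pow_mul]
      exact pow_le_pow_left₀ (by positivity) hc' k
    have h2 : 0 ≤ δ * y ^ (4 * k + 4) := by positivity
    calc x ^ 2 * y ^ (4 * k) ≤ x ^ 2 * (δ⁻¹ * x ^ 2) ^ k :=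
          mul_le_mul_of_nonneg_left h1 (by positivity)
      _ = (δ⁻¹) ^ k * x ^ (2 * k + 2) := by rw [mul_pow]; ring
      _ ≤ _ := by linarith

/-- The mixed term of the orbital derivative that does not involve `m` is dominated by
`x² y^{4k}`. -/
theorem pow_mul_pow_le {x y : ℝ} (hx : |x| ≤ 1) (hy : |y| ≤ 1) {k : ℕ} (hk : 0 < k) :
    x ^ (2 * k + 1) * y ^ (4 * k + 1) ≤ x ^ 2 * y ^ (4 * k) := by
  have hY : |y| ^ (4 * k) = y ^ (4 * k) := Even.pow_abs ⟨2 * k, by ring⟩ y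
  calc x ^ (2 * k + 1) * y ^ (4 * k + 1) ≤ |x ^ (2 * k + 1) * y ^ (4 * k + 1)| := le_abs_self _
    _ = |x| ^ (2 * k + 1) * |y| ^ (4 * k + 1) := by rw [abs_mul, abs_pow, abs_pow]
    _ ≤ |x| ^ 2 * |y| ^ (4 * k) := by
        gcongr ?_ * ?_
        · exact pow_le_pow_of_le_one (abs_nonneg x) hx (by omega)
        · exact pow_le_pow_of_le_one (abs_nonneg y) hy (by omega)
    _ = _ := by rw [hY, sq_abs]

theorem orbital_remainder_le {x y r M : ℝ} (hy : |y| ≤ r) (hr : r ≤ 1) {k s : ℕ}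
    (hk : 0 < k) (hsk : 2 * k < s) (hM : |M| * r ≤ 1 / 4) :
    -(M * x * y ^ (4 * k + 2 * s + 1)) ≤ x ^ 2 * y ^ (4 * k) + y ^ (4 * k + 4) / 4 := by
  have hY : |y| ^ (4 * k) = y ^ (4 * k) := Even.pow_abs ⟨2 * k, by ring⟩ y
  have hY0 : 0 ≤ y ^ (4 * k) := hY ▸ by positivity
  have hy1 := hy.trans hr
  have h1 : |x| * |y| ^ 3 ≤ x ^ 2 / 2 + y ^ 4 / 2 := by
    have h2 : |y| ^ 6 ≤ |y| ^ 4 := pow_le_pow_of_le_one (abs_nonneg y) hy1 (by norm_num)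
    rw [Even.pow_abs (by decide : Even 4)] at h2
    nlinarith [sq_nonneg (|x| - |y| ^ 3), sq_abs x]
  calc -(M * x * y ^ (4 * k + 2 * s + 1)) ≤ |M * x * y ^ (4 * k + 2 * s + 1)| := neg_le_abs _
    _ = |M| * |x| * |y| ^ (4 * k + 2 * s + 1) := by rw [abs_mul, abs_mul, abs_pow]
    _ ≤ |M| * |x| * |y| ^ (4 * k + 4) := by
        gcongr ?_ * ?_
        exact pow_le_pow_of_le_one (abs_nonneg y) hy1 (by omega)
    _ = |M| * |y| * (|x| * |y| ^ 3 * y ^ (4 * k)) := by rw [← hY]; ring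
    _ ≤ |M| * r * (|x| * |y| ^ 3 * y ^ (4 * k)) := by gcongr
    _ ≤ 1 / 4 * ((x ^ 2 / 2 + y ^ 4 / 2) * y ^ (4 * k)) := by gcongr
    _ ≤ x ^ 2 * y ^ (4 * k) + y ^ (4 * k + 4) / 4 := by
        have h2 : 0 ≤ x ^ 2 * y ^ (4 * k) := by positivity
        have h3 : 0 ≤ y ^ 4 * y ^ (4 * k) := by positivity
        rw [pow_add y (4 * k) 4]
        linarith

theorem mul_pow_le_mul_pow {y r m : ℝ} (hy : |y| ≤ r) (hr : r ≤ 1) {k s : ℕ} (hsk : 2 * k < s) :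
    m * y ^ (2 * s + 4) ≤ |m| * r * y ^ (4 * k + 4) := by
  have hy1 := hy.trans hr
  have hY : |y| ^ (4 * k + 4) = y ^ (4 * k + 4) := Even.pow_abs ⟨2 * k + 2, by ring⟩ y
  calc m * y ^ (2 * s + 4) ≤ |m * y ^ (2 * s + 4)| := le_abs_self _
    _ = |m| * |y| ^ (2 * s + 4) := by rw [abs_mul, abs_pow]
    _ ≤ |m| * (|y| ^ 1 * |y| ^ (4 * k + 4)) := by
        rw [← pow_add]
        gcongr ?_ * ?_
        exact pow_le_pow_of_le_one (abs_nonneg y) hy1 (by omega)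
    _ ≤ |m| * r * y ^ (4 * k + 4) := by
        rw [pow_one, hY, mul_assoc]
        have : 0 ≤ y ^ (4 * k + 4) := hY ▸ by positivity
        gcongr

/-- The Lyapunov function: the Hamiltonian `x²/2 + y⁴/4` corrected by a multiple of
`x y^{4k+1}`. -/
def bacciottiLyapunov (k : ℕ) (ε : ℝ) (p : ℝ × ℝ) : ℝ :=
  p.1 ^ 2 / 2 + p.2 ^ 4 / 4 - ε * (p.1 * p.2 ^ (4 * k + 1))

/-- The differential of `bacciottiLyapunov`. -/
def bacciottiLyapunovDeriv (k : ℕ) (ε : ℝ) (p : ℝ × ℝ) : ℝ × ℝ →L[ℝ] ℝ :=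
  (p.1 - ε * p.2 ^ (4 * k + 1)) • ContinuousLinearMap.fst ℝ ℝ ℝ +
    (p.2 ^ 3 - ε * ((4 * k + 1) * p.1 * p.2 ^ (4 * k))) • ContinuousLinearMap.snd ℝ ℝ ℝ

theorem hasFDerivAt_bacciottiLyapunov (k : ℕ) (ε : ℝ) (p : ℝ × ℝ) :
    HasFDerivAt (bacciottiLyapunov k ε) (bacciottiLyapunovDeriv k ε p) p := by
  have h1 : HasFDerivAt (fun q : ℝ × ℝ => q.1) (ContinuousLinearMap.fst ℝ ℝ ℝ) p := hasFDerivAt_fst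
  have h2 : HasFDerivAt (fun q : ℝ × ℝ => q.2) (ContinuousLinearMap.snd ℝ ℝ ℝ) p := hasFDerivAt_snd
  refine ((((h1.pow 2).mul_const (1 / 2)).add ((h2.pow 4).mul_const (1 / 4))).sub
    ((h1.mul (h2.pow (4 * k + 1))).const_mul ε)).congr_fderiv ?_ |>.congr_of_eventuallyEq ?_
  · ext <;> simp [bacciottiLyapunovDeriv, -mul_eq_mul_left_iff]
    ring
  · refine .of_forall fun q => ?_
    simp [bacciottiLyapunov]
    ring

theorem bacciottiLyapunovDeriv_apply (m : ℝ) (k s : ℕ) (ε x y : ℝ) :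
    bacciottiLyapunovDeriv k ε (x, y) (genBacciotti m k s (x, y)) =
      -x ^ (2 * k + 2) + m * y ^ (2 * s + 4) + ε * (-y ^ (4 * k + 4)
        + x ^ (2 * k + 1) * y ^ (4 * k + 1) + (4 * k + 1) * (x ^ 2 * y ^ (4 * k))
        + -((4 * k + 1) * m * x * y ^ (4 * k + 2 * s + 1))) := by
  simp [bacciottiLyapunovDeriv, genBacciotti]
  ring

theorem abs_mul_pow_le {x y : ℝ} (hy : |y| ≤ 1) {k : ℕ} (hk : 0 < k) :
    |x * y ^ (4 * k + 1)| ≤ (x ^ 2 + y ^ 4) / 2 := by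
  have h : |y| ^ (4 * k + 1) ≤ |y| ^ 2 := pow_le_pow_of_le_one (abs_nonneg y) hy (by omega)
  rw [abs_mul, abs_pow]
  nlinarith [mul_le_mul_of_nonneg_left h (abs_nonneg x), sq_nonneg (|x| - |y| ^ 2), sq_abs x,
    sq_abs y]

theorem norm_pow_four_le {p : ℝ × ℝ} (hp : ‖p‖ ≤ 1) : ‖p‖ ^ 4 ≤ p.1 ^ 2 + p.2 ^ 4 := by
  have h1 : |p.1| ≤ 1 := (norm_fst_le p).trans hp
  have h4 : |p.1| ^ 4 ≤ |p.1| ^ 2 := pow_le_pow_of_le_one (abs_nonneg _) h1 (by norm_num)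
  rw [sq_abs] at h4
  rcases max_choice ‖p.1‖ ‖p.2‖ with h | h <;> rw [Prod.norm_def, h, Real.norm_eq_abs]
  · linarith [Even.pow_nonneg (by decide : Even 4) p.2]
  · rw [Even.pow_abs (by decide : Even 4)]
    linarith [sq_nonneg p.1]

theorem bacciotti_orbital_derivative_le {m ε r x y : ℝ} {k s : ℕ} (hk : 0 < k) (hsk : 2 * k < s)
    (hε : 0 < ε) (hε' : ε * (4 * (4 * k + 3)) ^ (k + 1) = 1) (hr : r ≤ 1)
    (hM : |(4 * k + 1) * m| * r ≤ 1 / 4) (hm : |m| * r ≤ ε / 4) (hx : |x| ≤ r) (hy : |y| ≤ r) :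
    bacciottiLyapunovDeriv k ε (x, y) (genBacciotti m k s (x, y)) ≤
      -(ε / 4 * (x ^ (2 * k + 2) + y ^ (4 * k + 4))) := by
  have hA : 0 ≤ x ^ (2 * k + 2) := Even.pow_nonneg ⟨k + 1, by ring⟩ x
  have hB : 0 ≤ y ^ (4 * k + 4) := Even.pow_nonneg ⟨2 * k + 2, by ring⟩ y
  have hε1 : ε ≤ 1 := by
    rw [← hε']
    refine le_mul_of_one_le_right hε.le (one_le_pow₀ ?_)
    linarith [(Nat.cast_nonneg k : (0 : ℝ) ≤ k)]
  rw [bacciottiLyapunovDeriv_apply]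
  have h1 := pow_mul_pow_le (hx.trans hr) (hy.trans hr) hk
  have h2 := orbital_remainder_le (x := x) hy hr hk hsk hM
  have h3 : m * y ^ (2 * s + 4) ≤ ε / 4 * y ^ (4 * k + 4) :=
    (mul_pow_le_mul_pow hy hr hsk).trans (mul_le_mul_of_nonneg_right hm hB)
  set C : ℝ := 4 * k + 3 with hC
  have hCpos : 0 < C := by positivity
  have h4 := sq_mul_pow_le x y k (inv_pos.2 (mul_pos four_pos hCpos))
  rw [inv_inv] at h4
  have h5 : C * (x ^ 2 * y ^ (4 * k)) ≤
      y ^ (4 * k + 4) / 4 + C * (4 * C) ^ k * x ^ (2 * k + 2) := by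
    refine (mul_le_mul_of_nonneg_left h4 hCpos.le).trans_eq ?_
    field_simp
  have h6 : ε * (C * (4 * C) ^ k) = 1 / 4 := by
    rw [pow_succ] at hε'
    linarith
  have h7 : -y ^ (4 * k + 4) + x ^ (2 * k + 1) * y ^ (4 * k + 1)
      + (4 * k + 1) * (x ^ 2 * y ^ (4 * k)) + -((4 * k + 1) * m * x * y ^ (4 * k + 2 * s + 1))
      ≤ -(y ^ (4 * k + 4) / 2) + C * (4 * C) ^ k * x ^ (2 * k + 2) := by
    have h8 : C * (x ^ 2 * y ^ (4 * k)) = (4 * k + 1) * (x ^ 2 * y ^ (4 * k)) +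
      2 * (x ^ 2 * y ^ (4 * k)) := by rw [hC]; ring
    linarith
  have h9 := mul_le_mul_of_nonneg_left h7 hε.le
  rw [mul_add ε (-(y ^ (4 * k + 4) / 2)), ← mul_assoc ε (C * _), h6] at h9
  have h10 : ε * x ^ (2 * k + 2) ≤ 1 * x ^ (2 * k + 2) := mul_le_mul_of_nonneg_right hε1 hA
  linarith

theorem bacciottiLyapunov_bounds {ε : ℝ} {p : ℝ × ℝ} {k : ℕ} (hk : 0 < k) (hε : 0 ≤ ε)
    (hε1 : ε ≤ 1 / 4) (hp : ‖p‖ ≤ 1) :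
    1 / 8 * ‖p‖ ^ 4 ≤ bacciottiLyapunov k ε p ∧ bacciottiLyapunov k ε p ≤ p.1 ^ 2 + p.2 ^ 4 := by
  have h1 := abs_mul_pow_le (x := p.1) ((norm_snd_le p).trans hp) hk
  have h2 := norm_pow_four_le hp
  have h3 : |ε * (p.1 * p.2 ^ (4 * k + 1))| ≤ 1 / 4 * ((p.1 ^ 2 + p.2 ^ 4) / 2) := by
    rw [abs_mul, abs_of_nonneg hε]
    gcongr
  have h4 : 0 ≤ p.2 ^ 4 := by positivity
  obtain ⟨h5, h6⟩ := abs_le.1 h3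
  unfold bacciottiLyapunov
  constructor <;> linarith [sq_nonneg p.1]

theorem isLyapunovOn_genBacciotti (m : ℝ) {k s : ℕ} (hk : 0 < k) (hsk : 2 * k < s) :
    ∃ ε r c : ℝ, r ≤ 1 ∧ IsLyapunovOn (genBacciotti m k s) (bacciottiLyapunov k ε)
      (bacciottiLyapunovDeriv k ε) r (1 / 8) c 4 (k + 1) := by
  obtain ⟨ε, hε, hε'⟩ : ∃ ε : ℝ, 0 < ε ∧ ε * (4 * (4 * k + 3)) ^ (k + 1) = 1 :=
    ⟨((4 * (4 * k + 3)) ^ (k + 1))⁻¹, by positivity, inv_mul_cancel₀ (by positivity)⟩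
  have hε1 : ε ≤ 1 / 4 := by
    have hk0 : (0 : ℝ) ≤ k := k.cast_nonneg
    have h : (4 : ℝ) ≤ (4 * (4 * k + 3)) ^ (k + 1) :=
      le_trans (by linarith) (le_self_pow₀ (by linarith : (1 : ℝ) ≤ 4 * (4 * k + 3)) k.succ_ne_zero)
    nlinarith
  have hN : 0 < 4 * ((4 * k + 1) * (|m| + 1)) := by positivity
  set r : ℝ := min 1 (ε / (4 * ((4 * k + 1) * (|m| + 1)))) with hr_def
  have hr0 : 0 < r := lt_min one_pos (by positivity)
  have hr1 : r ≤ 1 := min_le_left _ _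
  have hr2 : (4 * k + 1) * (|m| + 1) * r ≤ ε / 4 := by
    have h := (le_div_iff₀ hN).1 (min_le_right _ _ : r ≤ ε / (4 * ((4 * k + 1) * (|m| + 1))))
    linarith
  have hM : |(4 * k + 1) * m| * r ≤ ε / 4 := by
    refine le_trans ?_ hr2
    rw [abs_mul, abs_of_nonneg (by positivity : (0 : ℝ) ≤ 4 * k + 1)]
    gcongr
    linarith
  have hm : |m| * r ≤ ε / 4 := by
    refine le_trans ?_ hM
    rw [abs_mul, abs_of_nonneg (by positivity : (0 : ℝ) ≤ 4 * k + 1)]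
    gcongr
    exact le_mul_of_one_le_left (abs_nonneg m) (by linarith [(Nat.cast_nonneg k : (0 : ℝ) ≤ k)])
  refine ⟨ε, r, ε / 4 / 2 ^ k, hr1, hasFDerivAt_bacciottiLyapunov k ε, by simp [bacciottiLyapunov],
    hr0, by norm_num, by positivity, by norm_num,
    fun p hp => (bacciottiLyapunov_bounds hk hε.le hε1 (hp.trans hr1)).1, fun p hp => ?_⟩
  obtain ⟨hlow, hup⟩ := bacciottiLyapunov_bounds hk hε.le hε1 (hp.trans hr1)
  refine (bacciotti_orbital_derivative_le hk hsk hε hε' hr1 (hM.trans (by linarith)) hm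
    ((norm_fst_le p).trans hp) ((norm_snd_le p).trans hp)).trans (neg_le_neg ?_)
  have hpow : bacciottiLyapunov k ε p ^ (k + 1) ≤
      2 ^ k * (p.1 ^ (2 * k + 2) + p.2 ^ (4 * k + 4)) := by
    calc bacciottiLyapunov k ε p ^ (k + 1) ≤ (p.1 ^ 2 + p.2 ^ 4) ^ (k + 1) :=
          pow_le_pow_left₀ (le_trans (by positivity) hlow) hup _
      _ ≤ 2 ^ k * ((p.1 ^ 2) ^ (k + 1) + (p.2 ^ 4) ^ (k + 1)) :=
          add_pow_le (by positivity) (by positivity) (k + 1)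
      _ = _ := by rw [← pow_mul, ← pow_mul]; rfl
  rw [div_mul_eq_mul_div, div_le_iff₀ (by positivity), mul_assoc]
  refine mul_le_mul_of_nonneg_left (hpow.trans_eq (mul_comm _ _)) (by positivity)

theorem genBacciotti_stability_s_gt_two_k (k s : ℕ) (hk : 0 < k) (hs : 0 < s)
    (hsk : 2 * k < s) (m : ℝ) :
    OriginIsAttractor (genBacciotti m k s) := by
  obtain ⟨ε, r, c, hr, h⟩ := isLyapunovOn_genBacciotti m hk hsk
  exact originIsAttractor_of_isLyapunovOn (contDiff_genBacciotti m k s) h hr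

end
end

section
/- Let k be a positive integer, s = 2k, and consider the planar vector field X_{m,k,s}(x,y) = (y³ − x^{2k+1}, −x + m·y^{4k+1}). Set m* = (2k+1)!!/(4k+1)!!!! = (∏_{i=0}^{k}(2i+1))/(∏_{i=0}^{k}(4i+1)). If m < m*, then the origin is an attractor (locally asymptotically stable) for X_{m,k,s}; if m > m*, then the origin is a repeller, i.e. an attractor for the time-reversed vector field −X_{m,k,s}. -/
open Real Filter Set

noncomputable section

/-- A bounded Lipschitz vector field on a Banach space has globally defined integral curves. -/
theorem exists_forall_hasDerivAt_of_lipschitz_of_bounded {E : Type*} [NormedAddCommGroup E]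
    [NormedSpace ℝ E] [CompleteSpace E] {Y : E → E} {K : NNReal} (hK : LipschitzWith K Y)
    {C : ℝ} (hC : ∀ p, ‖Y p‖ ≤ C) (p : E) :
    ∃ γ : ℝ → E, γ 0 = p ∧ ∀ t, HasDerivAt γ (Y (γ t)) t := by
  have hC0 : 0 ≤ C := (norm_nonneg _).trans (hC p)
  have hloc : ∀ n : ℕ, ∃ γ : ℝ → E, γ 0 = p ∧
      ∀ t ∈ Ioo (-(n + 1 : ℝ)) (n + 1), HasDerivAt γ (Y (γ t)) t := by
    intro n
    have hn : (0 : ℝ) < n + 1 := by positivity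
    have hPL : IsPicardLindelof (fun _ : ℝ => Y) (tmin := -(n + 1 : ℝ)) (tmax := n + 1)
        ⟨0, by constructor <;> linarith⟩ p (⟨C, hC0⟩ * (n + 1)) 0 ⟨C, hC0⟩ K :=
      { lipschitzOnWith := fun _ _ => hK.lipschitzOnWith
        continuousOn := fun _ _ => continuousOn_const
        norm_le := fun _ _ x _ => hC x
        mul_max_le := by simp; exact le_rfl }
    obtain ⟨γ, h0, hγ⟩ := hPL.exists_eq_forall_mem_Icc_hasDerivWithinAt₀
    exact ⟨γ, h0, fun t ht => (hγ t (Ioo_subset_Icc_self ht)).hasDerivAt (Icc_mem_nhds ht.1 ht.2)⟩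
  choose γ h0 hγ using hloc
  have hmono : ∀ n m : ℕ, n ≤ m → ∀ t : ℝ, |t| < n + 1 → γ n t = γ m t := by
    intro n m hnm t ht
    have hn : (0 : ℝ) < n + 1 := by positivity
    have hnm' : (n : ℝ) ≤ m := by exact_mod_cast hnm
    refine ODE_solution_unique_of_mem_Ioo (v := fun _ => Y) (s := fun _ => univ) (t₀ := 0)
      (a := -(n + 1 : ℝ)) (b := n + 1) (fun _ _ => hK.lipschitzOnWith) ⟨by linarith, hn⟩
      (fun s hs => ⟨hγ n s hs, trivial⟩)
      (fun s hs => ⟨hγ m s ⟨by linarith [hs.1], by linarith [hs.2]⟩, trivial⟩)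
      (by rw [h0, h0]) (abs_lt.1 ht)
  have heq : ∀ n m : ℕ, ∀ t : ℝ, |t| < n + 1 → |t| < m + 1 → γ n t = γ m t := by
    intro n m t hn hm
    rcases le_total n m with h | h
    · exact hmono n m h t hn
    · exact (hmono m n h t hm).symm
  have hceil : ∀ t : ℝ, |t| < ⌈|t|⌉₊ + 1 := fun t => (Nat.le_ceil _).trans_lt (lt_add_one _)
  refine ⟨fun t => γ ⌈|t|⌉₊ t, h0 _, fun t => ?_⟩
  refine (hγ ⌈|t|⌉₊ t (abs_lt.1 (hceil t))).congr_of_eventuallyEq ?_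
  filter_upwards [continuous_abs.continuousAt.eventually_lt_const (hceil t)] with s hs
  exact heq _ _ s (hceil s) hs

/-- Along a forward solution, a function whose orbital derivative is at most `-c` decreases at
rate at least `c`. -/
theorem IsForwardSolution.le_sub_mul {X : ℝ × ℝ → ℝ × ℝ} {γ : ℝ → ℝ × ℝ}
    (hγ : IsForwardSolution X γ) {V : ℝ × ℝ → ℝ} (hV : Differentiable ℝ V) {c T : ℝ} (hT : 0 ≤ T)
    (hc : ∀ t ∈ Ico 0 T, fderiv ℝ V (γ t) (X (γ t)) ≤ -c) :
    V (γ T) ≤ V (γ 0) - c * T := by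
  have hd : ∀ t ∈ Ici (0 : ℝ),
      HasDerivWithinAt (V ∘ γ) (fderiv ℝ V (γ t) (X (γ t))) (Ici 0) t := fun t ht =>
    (hV (γ t)).hasFDerivAt.comp_hasDerivWithinAt t (hγ t ht)
  have hB : ∀ t : ℝ, HasDerivAt (fun t => V (γ 0) - c * t) (-c) t := fun t => by
    simpa using ((hasDerivAt_id t).const_mul c).const_sub (V (γ 0))
  refine image_le_of_deriv_right_le_deriv_boundary (f := V ∘ γ)
    (B := fun t => V (γ 0) - c * t) (B' := fun _ => -c) (a := 0) (b := T)
    (fun t ht => ((hd t ht.1).continuousWithinAt).mono Icc_subset_Ici_self)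
    (fun t ht => (hd t ht.1).mono (Ici_subset_Ici.2 ht.1)) (by simp)
    (fun t _ => (hB t).continuousAt.continuousWithinAt)
    (fun t _ => (hB t).hasDerivWithinAt) hc ⟨hT, le_rfl⟩

theorem IsForwardSolution.continuousOn {X : ℝ × ℝ → ℝ × ℝ} {γ : ℝ → ℝ × ℝ}
    (hγ : IsForwardSolution X γ) : ContinuousOn γ (Ici 0) :=
  fun t ht => (hγ t ht).continuousWithinAt

theorem IsForwardSolution.comp_add_const {X : ℝ × ℝ → ℝ × ℝ} {γ : ℝ → ℝ × ℝ}
    (hγ : IsForwardSolution X γ) {a : ℝ} (ha : 0 ≤ a) :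
    IsForwardSolution X (fun t => γ (t + a)) := by
  intro t ht
  have h := (hγ (t + a) (add_nonneg ht ha)).scomp t
    (((hasDerivAt_id t).add_const a).hasDerivWithinAt (s := Ici 0))
    (fun s hs => add_nonneg hs ha)
  simpa [Function.comp_def] using h

/-- Lyapunov's stability theorem, with the field only controlled on a closed ball. -/
theorem exists_forall_norm_lt_of_lyapunov {X : ℝ × ℝ → ℝ × ℝ} {V : ℝ × ℝ → ℝ}
    (hV : Differentiable ℝ V) (hV0 : V 0 = 0) {R : ℝ}
    (hpos : ∀ p, p ≠ 0 → ‖p‖ ≤ R → 0 < V p)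
    (hneg : ∀ p, ‖p‖ ≤ R → fderiv ℝ V p (X p) ≤ 0) {ε : ℝ} (hε : 0 < ε) (hεR : ε ≤ R) :
    ∃ δ > (0 : ℝ), ∀ γ : ℝ → ℝ × ℝ,
      IsForwardSolution X γ → ‖γ 0‖ < δ → ∀ t ≥ (0 : ℝ), ‖γ t‖ < ε := by
  obtain ⟨q, hq, hqmin⟩ := (isCompact_sphere (0 : ℝ × ℝ) ε).exists_isMinOn
    (NormedSpace.sphere_nonempty.2 hε.le) hV.continuous.continuousOn
  have hqε : ‖q‖ = ε := by simpa using hq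
  have hVq : 0 < V q := hpos q (norm_pos_iff.1 (by rw [hqε]; exact hε)) (hqε.trans_le hεR)
  obtain ⟨δ, hδ, hδV⟩ := Metric.eventually_nhds_iff.1
    ((hV.continuous.continuousAt (x := 0)).eventually_lt_const (by rwa [hV0] : V 0 < V q))
  refine ⟨min δ ε, lt_min hδ hε, fun γ hγ h0 t ht => ?_⟩
  by_contra! hge
  have hcont : ContinuousOn (fun t => ‖γ t‖) (Icc 0 t) :=
    hγ.continuousOn.norm.mono Icc_subset_Ici_self
  have hcpt : IsCompact (Icc 0 t ∩ (fun t => ‖γ t‖) ⁻¹' Ici ε) :=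
    isCompact_Icc.of_isClosed_subset (hcont.preimage_isClosed_of_isClosed isClosed_Icc isClosed_Ici)
      inter_subset_left
  obtain ⟨τ, ⟨hτ, hτε⟩, hτmin⟩ := hcpt.exists_isLeast ⟨t, ⟨ht, le_rfl⟩, hge⟩
  have hlt : ∀ s ∈ Ico 0 τ, ‖γ s‖ < ε := by
    intro s hs
    by_contra! h
    exact absurd (hτmin ⟨⟨hs.1, hs.2.le.trans hτ.2⟩, h⟩) (not_le.2 hs.2)
  have hτeq : ‖γ τ‖ = ε := by
    obtain ⟨s, hs, hsε⟩ := intermediate_value_Icc hτ.1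
      (hcont.mono (Icc_subset_Icc_right hτ.2)) ⟨(h0.trans_le (min_le_right _ _)).le, hτε⟩
    have hsε' : ‖γ s‖ = ε := hsε
    rcases hs.2.lt_or_eq with h | h
    · exact absurd (hlt s ⟨hs.1, h⟩) (by rw [hsε']; exact lt_irrefl _)
    · rw [← h, hsε']
  have hle := hγ.le_sub_mul hV (c := 0) hτ.1
    (fun s hs => by simpa using hneg _ ((hlt s hs).le.trans hεR))
  have h1 : V (γ 0) < V q := hδV (by simpa using h0.trans_le (min_le_left _ _))
  have h2 : V q ≤ V (γ τ) := hqmin (by simpa using hτeq)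
  linarith

/-- Lyapunov's asymptotic stability theorem. -/
theorem originIsAttractor_of_lyapunov {X : ℝ × ℝ → ℝ × ℝ} {V : ℝ × ℝ → ℝ}
    (hX : ContDiff ℝ 1 X) (hX0 : X 0 = 0) (hV : ContDiff ℝ 1 V) (hV0 : V 0 = 0)
    (h : ∀ᶠ p in nhds (0 : ℝ × ℝ), p ≠ 0 → 0 < V p ∧ fderiv ℝ V p (X p) < 0) :
    OriginIsAttractor X := by
  obtain ⟨R, hR, hball⟩ := Metric.nhds_basis_closedBall.eventually_iff.1 h
  have hpos : ∀ p, p ≠ 0 → ‖p‖ ≤ R → 0 < V p := fun p hp hpR => (hball (by simpa using hpR) hp).1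
  have hneg : ∀ p, p ≠ 0 → ‖p‖ ≤ R → fderiv ℝ V p (X p) < 0 :=
    fun p hp hpR => (hball (by simpa using hpR) hp).2
  have hneg' : ∀ p, ‖p‖ ≤ R → fderiv ℝ V p (X p) ≤ 0 := by
    intro p hpR
    rcases eq_or_ne p 0 with rfl | hp
    · simp [hX0]
    · exact (hneg p hp hpR).le
  have hVd : Differentiable ℝ V := hV.differentiable one_ne_zero
  have hD : Continuous fun p => fderiv ℝ V p (X p) :=
    (hV.continuous_fderiv one_ne_zero).clm_apply hX.continuous
  have hstable := fun {ε : ℝ} (hε : 0 < ε) (hεR : ε ≤ R) =>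
    exists_forall_norm_lt_of_lyapunov hVd hV0 hpos hneg' hε hεR
  refine ⟨fun ε hε => ?_, ?_⟩
  · obtain ⟨δ, hδ, H⟩ := hstable (lt_min hε hR) (min_le_right _ _)
    exact ⟨δ, hδ, fun γ hγ h0 t ht => (H γ hγ h0 t ht).trans_le (min_le_left _ _)⟩
  let χ : ContDiffBump (0 : ℝ × ℝ) := ⟨R, R + 1, hR, by linarith⟩
  have hχ : ∀ p : ℝ × ℝ, ‖p‖ ≤ R → χ p • X p = X p := fun p hp => by
    rw [χ.one_of_mem_closedBall (by simpa using hp), one_smul]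
  have hYc : HasCompactSupport fun p => χ p • X p := χ.hasCompactSupport.smul_right
  have hYd : ContDiff ℝ 1 fun p => χ p • X p := χ.contDiff.smul hX
  obtain ⟨K, hK⟩ := hYd.lipschitzWith_of_hasCompactSupport hYc one_ne_zero
  obtain ⟨C, hC⟩ := hYc.exists_bound_of_continuous hYd.continuous
  obtain ⟨δ, hδ, H⟩ := exists_forall_norm_lt_of_lyapunov (X := fun p => χ p • X p) hVd hV0 hpos
    (fun p hp => by simpa only [hχ p hp] using hneg' p hp) hR le_rfl
  refine ⟨δ, hδ, fun p hp => ?_⟩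
  obtain ⟨γ, h0, hγ⟩ := exists_forall_hasDerivAt_of_lipschitz_of_bounded hK hC p
  have hγR : ∀ t ≥ (0 : ℝ), ‖γ t‖ < R :=
    H γ (fun t _ => (hγ t).hasDerivWithinAt) (by rwa [h0])
  have hγX : IsForwardSolution X γ := fun t ht => by
    simpa only [hχ _ (hγR t ht).le] using (hγ t).hasDerivWithinAt (s := Ici 0)
  refine ⟨γ, hγX, h0, ?_⟩
  rw [Metric.tendsto_atTop]
  intro η hη
  obtain ⟨ρ, hρ, Hρ⟩ := hstable (lt_min hη hR) (min_le_right _ _)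
  have hret : ∃ T ≥ (0 : ℝ), ‖γ T‖ < ρ := by
    by_contra! hfar
    have hcpt : IsCompact (Metric.closedBall (0 : ℝ × ℝ) R ∩ {q | ρ ≤ ‖q‖}) :=
      (isCompact_closedBall _ _).inter_right (isClosed_le continuous_const continuous_norm)
    obtain ⟨q, ⟨hqR, hqρ⟩, hqmax⟩ := hcpt.exists_isMaxOn
      ⟨γ 0, by simpa using (hγR 0 le_rfl).le, hfar 0 le_rfl⟩ hD.continuousOn
    have hqneg : fderiv ℝ V q (X q) < 0 :=
      hneg q (norm_pos_iff.1 (hρ.trans_le hqρ)) (by simpa using hqR)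
    set c := -fderiv ℝ V q (X q) with hc
    have hcpos : 0 < c := neg_pos.2 hqneg
    have hT : 0 ≤ (|V (γ 0)| + 1) / c := by positivity
    have hle := hγX.le_sub_mul hVd (c := c) hT (fun t ht => by
      rw [hc, neg_neg]
      exact hqmax ⟨by simpa using (hγR t ht.1).le, hfar t ht.1⟩)
    rw [mul_div_cancel₀ _ hcpos.ne'] at hle
    have := hpos _ (norm_pos_iff.1 (hρ.trans_le (hfar _ hT))) (hγR _ hT).le
    linarith [le_abs_self (V (γ 0))]
  obtain ⟨T, hT, hTρ⟩ := hret
  refine ⟨T, fun t ht => ?_⟩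
  have := Hρ _ (hγX.comp_add_const hT) (by simpa using hTρ) (t - T) (sub_nonneg.2 ht)
  simpa using this.trans_le (min_le_left _ _)

/-- The gauge that is homogeneous of degree one when `x` has weight two and `y` has weight one. -/
def quasiNorm (p : ℝ × ℝ) : ℝ := max (√|p.1|) |p.2|

theorem quasiNorm_nonneg (p : ℝ × ℝ) : 0 ≤ quasiNorm p :=
  (abs_nonneg _).trans (le_max_right _ _)

theorem continuous_quasiNorm : Continuous quasiNorm := by
  unfold quasiNorm
  fun_prop

theorem abs_fst_le_quasiNorm_sq (p : ℝ × ℝ) : |p.1| ≤ quasiNorm p ^ 2 := by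
  calc |p.1| = √|p.1| ^ 2 := (Real.sq_sqrt (abs_nonneg _)).symm
    _ ≤ quasiNorm p ^ 2 := pow_le_pow_left₀ (Real.sqrt_nonneg _) (le_max_left _ _) 2

theorem quasiNorm_pos {p : ℝ × ℝ} (hp : p ≠ 0) : 0 < quasiNorm p := by
  refine (quasiNorm_nonneg p).lt_of_ne fun h => hp ?_
  have h1 : |p.1| ≤ 0 := by simpa [← h] using abs_fst_le_quasiNorm_sq p
  have h2 : |p.2| ≤ 0 := (le_max_right (√|p.1|) _).trans h.ge
  exact Prod.ext (abs_nonpos_iff.1 h1) (abs_nonpos_iff.1 h2)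

theorem monomial_isBigO_quasiNorm (a b : ℕ) :
    (fun p : ℝ × ℝ => p.1 ^ a * p.2 ^ b) =O[nhds 0] fun p => quasiNorm p ^ (2 * a + b) := by
  refine Asymptotics.isBigO_of_le _ fun p => ?_
  rw [norm_mul, norm_pow, norm_pow, Real.norm_eq_abs, Real.norm_eq_abs, pow_add, pow_mul,
    Real.norm_of_nonneg (by have := quasiNorm_nonneg p; positivity)]
  gcongr
  · exact abs_fst_le_quasiNorm_sq p
  · exact le_max_right _ _

theorem quasiNorm_pow_isBigO {a b : ℕ} (h : a ≤ b) :
    (fun p => quasiNorm p ^ b) =O[nhds 0] fun p => quasiNorm p ^ a := by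
  have h1 : ∀ᶠ p in nhds (0 : ℝ × ℝ), quasiNorm p < 1 :=
    continuous_quasiNorm.continuousAt.eventually_lt_const (by simp [quasiNorm])
  refine Asymptotics.IsBigO.of_bound' (h1.mono fun p hp => ?_)
  have := quasiNorm_nonneg p
  rw [Real.norm_of_nonneg (by positivity), Real.norm_of_nonneg (by positivity)]
  exact pow_le_pow_of_le_one this hp.le h

theorem min_mul_quasiNorm_pow_le {α β : ℝ} (hα : 0 < α) (hβ : 0 < β) (n : ℕ) (p : ℝ × ℝ) :
    min α β * quasiNorm p ^ (4 * n) ≤ α * p.1 ^ (2 * n) + β * p.2 ^ (4 * n) := by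
  have hx : 0 ≤ p.1 ^ (2 * n) := (even_two_mul n).pow_nonneg _
  have hy : 0 ≤ p.2 ^ (4 * n) := Even.pow_nonneg ⟨2 * n, by ring⟩ _
  have hx' : √|p.1| ^ (4 * n) = p.1 ^ (2 * n) := by
    rw [show 4 * n = 2 * (2 * n) by ring, pow_mul, Real.sq_sqrt (abs_nonneg _),
      (even_two_mul n).pow_abs]
  have hy' : |p.2| ^ (4 * n) = p.2 ^ (4 * n) := Even.pow_abs ⟨2 * n, by ring⟩ _
  rcases max_choice (√|p.1|) |p.2| with h | h <;> rw [quasiNorm, h]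
  · rw [hx']
    nlinarith [min_le_left α β, mul_nonneg hβ.le hy]
  · rw [hy']
    nlinarith [min_le_right α β, mul_nonneg hα.le hx]

/-- A quasi-homogeneous definite form dominates every term of higher weighted order. -/
theorem eventually_abs_lt_of_isBigO_quasiNorm {α β : ℝ} (hα : 0 < α) (hβ : 0 < β) {n : ℕ}
    {g : ℝ × ℝ → ℝ} (hg : g =O[nhds 0] fun p => quasiNorm p ^ (4 * n + 1)) :
    ∀ᶠ p in nhds (0 : ℝ × ℝ), p ≠ 0 → |g p| < α * p.1 ^ (2 * n) + β * p.2 ^ (4 * n) := by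
  obtain ⟨C, hC, hgC⟩ := hg.exists_pos
  have hμ : 0 < min α β := lt_min hα hβ
  have hsmall : ∀ᶠ p in nhds (0 : ℝ × ℝ), quasiNorm p < min α β / C :=
    continuous_quasiNorm.continuousAt.eventually_lt_const
      (by simpa [quasiNorm] using div_pos hμ hC)
  filter_upwards [hgC.bound, hsmall] with p hp hs hp0
  have hq := quasiNorm_pos hp0
  rw [Real.norm_eq_abs, Real.norm_of_nonneg (by positivity), pow_succ] at hp
  rw [lt_div_iff₀ hC] at hs
  calc |g p| ≤ (quasiNorm p * C) * quasiNorm p ^ (4 * n) := by linarith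
    _ < min α β * quasiNorm p ^ (4 * n) := by gcongr
    _ ≤ _ := min_mul_quasiNorm_pow_le hα hβ n p

theorem fderiv_monomial_apply (a b : ℕ) (p v : ℝ × ℝ) :
    fderiv ℝ (fun p : ℝ × ℝ => p.1 ^ (a + 1) * p.2 ^ (b + 1)) p v =
      (a + 1) * (p.1 ^ a * p.2 ^ (b + 1)) * v.1 + (b + 1) * (p.1 ^ (a + 1) * p.2 ^ b) * v.2 := by
  have h1 : HasFDerivAt (fun p : ℝ × ℝ => p.1) (ContinuousLinearMap.fst ℝ ℝ ℝ) p := hasFDerivAt_fst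
  have h2 : HasFDerivAt (fun p : ℝ × ℝ => p.2) (ContinuousLinearMap.snd ℝ ℝ ℝ) p := hasFDerivAt_snd
  rw [((h1.pow (a + 1)).fun_mul (h2.pow (b + 1))).fderiv]
  simp
  ring

/-- Along the Hamiltonian field `(y³, -x)`, the monomials `y ^ (4 (i + l))` and
`x ^ (2 i) y ^ (4 l)` are proportional up to the derivative of a quasi-homogeneous polynomial. -/
theorem exists_hamiltonian_primitive (i : ℕ) : ∀ l d : ℕ, d + 3 = 4 * (i + l) →
    ∃ W : ℝ × ℝ → ℝ, ContDiff ℝ 1 W ∧ W 0 = 0 ∧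
      W =O[nhds 0] (fun p => quasiNorm p ^ (d + 2)) ∧
      (fun p => fderiv ℝ W p (1, 0)) =O[nhds 0] (fun p => quasiNorm p ^ d) ∧
      (fun p => fderiv ℝ W p (0, 1)) =O[nhds 0] (fun p => quasiNorm p ^ (d + 1)) ∧
      ∀ p, fderiv ℝ W p (p.2 ^ 3, -p.1) =
        (∏ j ∈ Finset.range i, (2 * (j : ℝ) + 1)) * p.2 ^ (4 * (i + l)) -
        (∏ j ∈ Finset.range i, (4 * ((l : ℝ) + j) + 1)) * (p.1 ^ (2 * i) * p.2 ^ (4 * l)) := by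
  induction i with
  | zero =>
    intro l d _
    refine ⟨fun _ => 0, contDiff_const, rfl, ?_, ?_, ?_, fun p => ?_⟩
    all_goals simp [Asymptotics.isBigO_zero]
  | succ i ih =>
    intro l d hd
    obtain rfl : d = 4 * i + 4 * l + 1 := by omega
    obtain ⟨W, hW, hW0, hWO, hWx, hWy, hWH⟩ := ih (l + 1) (4 * i + 4 * l + 1) (by omega)
    set B : ℝ := ∏ j ∈ Finset.range i, (4 * (((l + 1 : ℕ) : ℝ) + j) + 1) with hB
    have hg : ContDiff ℝ 1 fun p : ℝ × ℝ => p.1 ^ (2 * i + 1) * p.2 ^ (4 * l + 1) := by fun_prop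
    have hfd : ∀ p v, fderiv ℝ (fun p : ℝ × ℝ => (2 * (i : ℝ) + 1) * W p +
        B * (p.1 ^ (2 * i + 1) * p.2 ^ (4 * l + 1))) p v =
        (2 * (i : ℝ) + 1) * fderiv ℝ W p v +
        B * fderiv ℝ (fun p : ℝ × ℝ => p.1 ^ (2 * i + 1) * p.2 ^ (4 * l + 1)) p v := by
      intro p v
      have h1 := (hW.differentiable one_ne_zero p).hasFDerivAt
      have h2 := (hg.differentiable one_ne_zero p).hasFDerivAt
      rw [((h1.const_mul (2 * (i : ℝ) + 1)).fun_add (h2.const_mul B)).fderiv]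
      simp
    have hO : ∀ a b n : ℕ, 2 * a + b = n → ∀ c : ℝ,
        (fun p : ℝ × ℝ => c * (p.1 ^ a * p.2 ^ b)) =O[nhds 0] fun p => quasiNorm p ^ n := by
      rintro a b n rfl c
      exact (monomial_isBigO_quasiNorm a b).const_mul_left c
    refine ⟨fun p => (2 * (i : ℝ) + 1) * W p + B * (p.1 ^ (2 * i + 1) * p.2 ^ (4 * l + 1)),
      (contDiff_const.mul hW).add (contDiff_const.mul hg), by simp [hW0],
      (hWO.const_mul_left _).add (hO _ _ _ (by ring) _), ?_, ?_, fun p => ?_⟩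
    · simp only [hfd, fderiv_monomial_apply, mul_one, mul_zero, add_zero]
      exact (hWx.const_mul_left _).add ((hO _ _ _ (by ring) _).const_mul_left _)
    · simp only [hfd, fderiv_monomial_apply, mul_one, mul_zero, zero_add]
      exact (hWy.const_mul_left _).add ((hO _ _ _ (by ring) _).const_mul_left _)
    · have hB' : ∏ j ∈ Finset.range (i + 1), (4 * ((l : ℝ) + j) + 1) = (4 * l + 1) * B := by
        rw [Finset.prod_range_succ', hB, mul_comm]
        congr 1
        · simp
        · exact Finset.prod_congr rfl fun j _ => by push_cast; ring
      rw [hfd, hWH, fderiv_monomial_apply, hB', Finset.prod_range_succ]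
      push_cast
      ring

/-- A signed multiple `σ` of the system is asymptotically stable at the origin as soon as some
multiple `c` of the Hamiltonian primitive makes the leading orbital derivative definite. -/
theorem originIsAttractor_smul_genBacciotti {k : ℕ} (hk : 0 < k) {m σ c : ℝ}
    (hx : 0 < σ * (1 + c * ∏ i ∈ Finset.range (k + 1), (4 * (i : ℝ) + 1)))
    (hy : 0 < -(σ * (m + c * ∏ i ∈ Finset.range (k + 1), (2 * (i : ℝ) + 1)))) :
    OriginIsAttractor fun p => σ • genBacciotti m k (2 * k) p := by
  obtain ⟨W, hW, hW0, hWO, hWx, hWy, hWH⟩ :=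
    exists_hamiltonian_primitive (k + 1) 0 (4 * k + 1) (by ring)
  simp only [Nat.cast_zero, zero_add, add_zero, mul_zero, pow_zero, mul_one] at hWH
  set A : ℝ := ∏ i ∈ Finset.range (k + 1), (2 * (i : ℝ) + 1)
  set B : ℝ := ∏ i ∈ Finset.range (k + 1), (4 * (i : ℝ) + 1)
  have hH : ContDiff ℝ 1 fun p : ℝ × ℝ => 1 / 2 * p.1 ^ 2 + 1 / 4 * p.2 ^ 4 := by fun_prop
  have hHd : ∀ p v : ℝ × ℝ, fderiv ℝ (fun p : ℝ × ℝ => 1 / 2 * p.1 ^ 2 + 1 / 4 * p.2 ^ 4) p v =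
      p.1 * v.1 + p.2 ^ 3 * v.2 := by
    intro p v
    have h1 : HasFDerivAt (fun p : ℝ × ℝ => p.1) (ContinuousLinearMap.fst ℝ ℝ ℝ) p :=
      hasFDerivAt_fst
    have h2 : HasFDerivAt (fun p : ℝ × ℝ => p.2) (ContinuousLinearMap.snd ℝ ℝ ℝ) p :=
      hasFDerivAt_snd
    rw [(((h1.pow 2).const_mul (1 / 2 : ℝ)).fun_add
      ((h2.pow 4).const_mul (1 / 4 : ℝ))).fderiv]
    simp
    ring
  have hX : ContDiff ℝ 1 fun p => σ • genBacciotti m k (2 * k) p := by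
    unfold genBacciotti
    fun_prop
  have hVd : ∀ p v : ℝ × ℝ, fderiv ℝ (fun p : ℝ × ℝ =>
      (1 / 2 * p.1 ^ 2 + 1 / 4 * p.2 ^ 4) + c * W p) p v =
      p.1 * v.1 + p.2 ^ 3 * v.2 + c * fderiv ℝ W p v := by
    intro p v
    have h1 := (hH.differentiable one_ne_zero p).hasFDerivAt
    have h2 := (hW.differentiable one_ne_zero p).hasFDerivAt
    rw [(h1.fun_add (h2.const_mul c)).fderiv, ← hHd]
    simp
  have hWsplit : ∀ p, fderiv ℝ W p (genBacciotti m k (2 * k) p) =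
      A * p.2 ^ (4 * (k + 1)) - B * p.1 ^ (2 * (k + 1)) +
      (-(p.1 ^ (2 * k + 1) * fderiv ℝ W p (1, 0)) +
        m * (p.2 ^ (4 * k + 1) * fderiv ℝ W p (0, 1))) := by
    intro p
    have : genBacciotti m k (2 * k) p = (p.2 ^ 3, -p.1) +
        ((-p.1 ^ (2 * k + 1)) • ((1 : ℝ), (0 : ℝ)) +
          (m * p.2 ^ (4 * k + 1)) • ((0 : ℝ), (1 : ℝ))) := by
      refine Prod.ext ?_ ?_
      · simp [genBacciotti]
        ring
      · simp only [genBacciotti, Prod.snd_add, Prod.smul_snd, smul_eq_mul]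
        ring
    rw [this, map_add, map_add, map_smul, map_smul, hWH]
    simp only [smul_eq_mul]
    ring
  have hrem : (fun p => σ * c * (-(p.1 ^ (2 * k + 1) * fderiv ℝ W p (1, 0)) +
      m * (p.2 ^ (4 * k + 1) * fderiv ℝ W p (0, 1)))) =O[nhds 0]
      fun p => quasiNorm p ^ (4 * (k + 1) + 1) := by
    have h1 := (monomial_isBigO_quasiNorm (2 * k + 1) 0).mul hWx
    have h2 := (monomial_isBigO_quasiNorm 0 (4 * k + 1)).mul hWy
    simp only [← pow_add, pow_zero, mul_one, one_mul] at h1 h2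
    exact (((h1.trans (quasiNorm_pow_isBigO (by omega))).neg_left).add
      ((h2.trans (quasiNorm_pow_isBigO (by omega))).const_mul_left m)).const_mul_left _
  have hWO' : (fun p => c * W p) =O[nhds 0] fun p => quasiNorm p ^ (4 * 1 + 1) :=
    (hWO.trans (quasiNorm_pow_isBigO (by omega))).const_mul_left c
  refine originIsAttractor_of_lyapunov hX (by simp [genBacciotti])
    (hH.add ((contDiff_const (c := c)).mul hW)) (by simp [hW0]) ?_
  filter_upwards [eventually_abs_lt_of_isBigO_quasiNorm (by norm_num : (0 : ℝ) < 1 / 2)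
    (by norm_num : (0 : ℝ) < 1 / 4) hWO', eventually_abs_lt_of_isBigO_quasiNorm hx hy hrem]
    with p hp1 hp2 hp0
  constructor
  · have h1 := (neg_le_abs _).trans_lt (hp1 hp0)
    simp only [mul_one] at h1
    linarith
  · have h1 := (le_abs_self _).trans_lt (hp2 hp0)
    have h2 : p.1 * (genBacciotti m k (2 * k) p).1 + p.2 ^ 3 * (genBacciotti m k (2 * k) p).2 =
        m * p.2 ^ (4 * (k + 1)) - p.1 ^ (2 * (k + 1)) := by
      simp only [genBacciotti]
      ring
    rw [map_smul, hVd, h2, hWsplit, smul_eq_mul]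
    linarith

theorem genBacciotti_stability_s_eq_two_k (k : ℕ) (hk : 0 < k) (m : ℝ) :
    (m < (∏ i ∈ Finset.range (k + 1), (2 * (i : ℝ) + 1)) /
          (∏ i ∈ Finset.range (k + 1), (4 * (i : ℝ) + 1)) →
        OriginIsAttractor (genBacciotti m k (2 * k))) ∧
    ((∏ i ∈ Finset.range (k + 1), (2 * (i : ℝ) + 1)) /
          (∏ i ∈ Finset.range (k + 1), (4 * (i : ℝ) + 1)) < m →
        OriginIsRepeller (genBacciotti m k (2 * k))) := by
  have hA : 0 < ∏ i ∈ Finset.range (k + 1), (2 * (i : ℝ) + 1) :=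
    Finset.prod_pos fun i _ => by positivity
  have hB : 0 < ∏ i ∈ Finset.range (k + 1), (4 * (i : ℝ) + 1) :=
    Finset.prod_pos fun i _ => by positivity
  have key := fun (σ c : ℝ) => originIsAttractor_smul_genBacciotti hk (m := m) (σ := σ) (c := c)
  set A : ℝ := ∏ i ∈ Finset.range (k + 1), (2 * (i : ℝ) + 1)
  set B : ℝ := ∏ i ∈ Finset.range (k + 1), (4 * (i : ℝ) + 1)
  constructor
  · intro hm
    obtain ⟨c, hc1, hc2⟩ : ∃ c, -1 / B < c ∧ c < -m / A := exists_between (by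
      rw [lt_div_iff₀ hB] at hm
      rw [div_lt_div_iff₀ hB hA]
      linarith)
    rw [div_lt_iff₀ hB] at hc1
    rw [lt_div_iff₀ hA] at hc2
    simpa using key 1 c (by linarith) (by linarith)
  · intro hm
    obtain ⟨c, hc1, hc2⟩ : ∃ c, -m / A < c ∧ c < -1 / B := exists_between (by
      rw [div_lt_iff₀ hB] at hm
      rw [div_lt_div_iff₀ hA hB]
      linarith)
    rw [div_lt_iff₀ hA] at hc1
    rw [lt_div_iff₀ hB] at hc2
    simpa [OriginIsRepeller] using key (-1) c (by linarith) (by linarith)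

end
end
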